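/- Fix ν ∈ ℝ and set A = 2(ν+1)M₁ − 2M₂, B = ½(2ν+1)(2ν+3)L − R₁ − (4ν+3)R₂, C = L, D = M₁, where L, M₁, M₂, R₁, R₂ are the S-Heun operators on the discrete linear grid. Then, as operators (acting on all functions f : ℝ → ℝ), the following quadratic relations of the degenerate Sklyanin algebra Skl₄ hold: [C,D] = 0, [A,C] = {C,D}, [A,D] = {C,C} (= 2C²), [B,C] = {D,A}, [B,D] = {C,A}, and [B,A] = {B,D}. -/

import Mathlib

/-- Lowering S-Heun operator `L = ½(T₊ − T₋)` on the discrete linear grid. -/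
noncomputable def opL (f : ℝ → ℝ) : ℝ → ℝ := fun x => (f (x+1) - f (x-1)) / 2
/-- Stabilizing S-Heun operator `M₁ = ½(T₊ + T₋)`. -/
noncomputable def opM1 (f : ℝ → ℝ) : ℝ → ℝ := fun x => (f (x+1) + f (x-1)) / 2
/-- Stabilizing S-Heun operator `M₂ = ½ x (T₊ − T₋)`. -/
noncomputable def opM2 (f : ℝ → ℝ) : ℝ → ℝ := fun x => x * (f (x+1) - f (x-1)) / 2
/-- Raising S-Heun operator `R₁ = ½ x [(1−2x)T₊ + (1+2x)T₋]`. -/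
noncomputable def opR1 (f : ℝ → ℝ) : ℝ → ℝ :=
  fun x => x * ((1 - 2*x) * f (x+1) + (1 + 2*x) * f (x-1)) / 2
/-- Raising S-Heun operator `R₂ = ½ x (T₊ + T₋)`. -/
noncomputable def opR2 (f : ℝ → ℝ) : ℝ → ℝ := fun x => x * (f (x+1) + f (x-1)) / 2

/-- `A = 2(ν+1)M₁ − 2M₂`. -/
noncomputable def sklA (ν : ℝ) (f : ℝ → ℝ) : ℝ → ℝ :=
  fun x => 2*(ν+1) * opM1 f x - 2 * opM2 f x
/-- `B = ½(2ν+1)(2ν+3)L − R₁ − (4ν+3)R₂`. -/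
noncomputable def sklB (ν : ℝ) (f : ℝ → ℝ) : ℝ → ℝ :=
  fun x => (1/2)*(2*ν+1)*(2*ν+3) * opL f x - opR1 f x - (4*ν+3) * opR2 f x
/-- `C = L`. -/
noncomputable def sklC (f : ℝ → ℝ) : ℝ → ℝ := opL f
/-- `D = M₁`. -/
noncomputable def sklD (f : ℝ → ℝ) : ℝ → ℝ := opM1 f

theorem stmt_6 (ν : ℝ) :
    (∀ (f : ℝ → ℝ) (x : ℝ), sklC (sklD f) x - sklD (sklC f) x = 0) ∧
    (∀ (f : ℝ → ℝ) (x : ℝ), sklA ν (sklC f) x - sklC (sklA ν f) x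
        = sklC (sklD f) x + sklD (sklC f) x) ∧
    (∀ (f : ℝ → ℝ) (x : ℝ), sklA ν (sklD f) x - sklD (sklA ν f) x
        = sklC (sklC f) x + sklC (sklC f) x) ∧
    (∀ (f : ℝ → ℝ) (x : ℝ), sklB ν (sklC f) x - sklC (sklB ν f) x
        = sklD (sklA ν f) x + sklA ν (sklD f) x) ∧
    (∀ (f : ℝ → ℝ) (x : ℝ), sklB ν (sklD f) x - sklD (sklB ν f) x
        = sklC (sklA ν f) x + sklA ν (sklC f) x) ∧
    (∀ (f : ℝ → ℝ) (x : ℝ), sklB ν (sklA ν f) x - sklA ν (sklB ν f) x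
        = sklB ν (sklD f) x + sklD (sklB ν f) x) := by
  refine ⟨?_, ?_, ?_, ?_, ?_, ?_⟩ <;> intro f x <;>
    simp only [sklA, sklB, sklC, sklD, opL, opM1, opM2, opR1, opR2] <;>
    have h1 : x + 1 + 1 = x + 2 := by ring
  all_goals
    have h2 : x - 1 - 1 = x - 2 := by ring
    have h3 : x + 1 - 1 = x := by ring
    have h4 : x - 1 + 1 = x := by ring
    simp only [h1, h2, h3, h4]
    ring
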